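/- arXiv:1005.3078 — 2 statements merged into one kernel-verified Lean document; each statement's English description precedes it below -/
import Mathlib

section
/- (Energy conservation for the rigid body in a potential field) Let 𝕀 be a symmetric positive-definite 3×3 real matrix, let U : (3×3 real matrices) → ℝ be differentiable, and define the torque τ(Q) ∈ ℝ³ by the requirement ⟨τ(Q), y⟩ = −DU(Q)·(Q·ŷ) for all y ∈ ℝ³, where DU(Q) is the Fréchet derivative of U at Q. Suppose Q : ℝ → 3×3 real matrices and W : ℝ → ℝ³ are differentiable and satisfy Q′(t) = Q(t)·Ŵ(t) and 𝕀·W′(t) = (𝕀·W(t)) × W(t) + τ(Q(t)) for all t. Then the total energy E(t) := ½⟨W(t), 𝕀·W(t)⟩ + U(Q(t)) is constant in t. -/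
open Matrix

attribute [local instance] Matrix.frobeniusNormedAddCommGroup Matrix.frobeniusNormedSpace

/-- The hat map sending `x ∈ ℝ³` to the skew-symmetric matrix `x̂`
with `x̂ · y = x × y`. -/
def hat (x : Fin 3 → ℝ) : Matrix (Fin 3) (Fin 3) ℝ :=
  !![0, -x 2, x 1; x 2, 0, -x 0; -x 1, x 0, 0]

/-- The Euclidean inner product on `ℝ³`. -/
def dot3 (x y : Fin 3 → ℝ) : ℝ := ∑ i, x i * y i

/-- The cross product on `ℝ³`. -/
def cross3 (x y : Fin 3 → ℝ) : Fin 3 → ℝ :=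
  ![x 1 * y 2 - x 2 * y 1, x 2 * y 0 - x 0 * y 2, x 0 * y 1 - x 1 * y 0]

theorem HasDerivAt.dot3 {f g : ℝ → Fin 3 → ℝ} {f' g' : Fin 3 → ℝ} {t : ℝ}
    (hf : HasDerivAt f f' t) (hg : HasDerivAt g g' t) :
    HasDerivAt (fun s => _root_.dot3 (f s) (g s))
      (_root_.dot3 f' (g t) + _root_.dot3 (f t) g') t := by
  rw [hasDerivAt_pi] at hf hg
  unfold _root_.dot3
  rw [← Finset.sum_add_distrib]
  exact HasDerivAt.fun_sum fun i _ => (hf i).mul (hg i)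

theorem HasDerivAt.const_mulVec (A : Matrix (Fin 3) (Fin 3) ℝ) {f : ℝ → Fin 3 → ℝ}
    {f' : Fin 3 → ℝ} {t : ℝ} (hf : HasDerivAt f f' t) :
    HasDerivAt (fun s => A *ᵥ f s) (A *ᵥ f') t := by
  rw [hasDerivAt_pi] at hf ⊢
  intro i
  simp only [mulVec, dotProduct]
  exact HasDerivAt.fun_sum fun j _ => (hf j).const_mul (A i j)

theorem dot3_comm (x y : Fin 3 → ℝ) : dot3 x y = dot3 y x :=
  dotProduct_comm x y

theorem dot3_add_left (x y z : Fin 3 → ℝ) : dot3 (x + y) z = dot3 x z + dot3 y z :=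
  add_dotProduct x y z

theorem dot3_cross3_self (x y : Fin 3 → ℝ) : dot3 (cross3 x y) y = 0 := by
  simp only [dot3, cross3, Fin.sum_univ_three, cons_val]
  ring

/-- A symmetric matrix is self-adjoint for the Euclidean inner product. -/
theorem Matrix.IsHermitian.dot3_mulVec {A : Matrix (Fin 3) (Fin 3) ℝ} (hA : A.IsHermitian)
    (x y : Fin 3 → ℝ) : dot3 x (A *ᵥ y) = dot3 (A *ᵥ x) y := by
  have hT : Aᵀ = A := by rw [← conjTranspose_eq_transpose_of_trivial, hA.eq]
  change x ⬝ᵥ A *ᵥ y = (A *ᵥ x) ⬝ᵥ y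
  rw [dotProduct_mulVec, ← mulVec_transpose, hT]

/-- Energy conservation for a rigid body in a potential field: along solutions of
`Q′ = Q Ŵ`, `𝕀 W′ = (𝕀 W) × W + τ(Q)` with torque `⟨τ(Q), y⟩ = −DU(Q)·(Q ŷ)`,
the total energy `E(t) = ½⟨W, 𝕀 W⟩ + U(Q)` is constant. -/
theorem rigid_body_energy_conservation
    (𝕀 : Matrix (Fin 3) (Fin 3) ℝ) (h𝕀sym : 𝕀.IsHermitian) (h𝕀pos : 𝕀.PosDef)
    (U : Matrix (Fin 3) (Fin 3) ℝ → ℝ) (hU : Differentiable ℝ U)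
    (τ : Matrix (Fin 3) (Fin 3) ℝ → Fin 3 → ℝ)
    (hτ : ∀ (Q : Matrix (Fin 3) (Fin 3) ℝ) (y : Fin 3 → ℝ),
      dot3 (τ Q) y = -(fderiv ℝ U Q (Q * hat y)))
    (Q : ℝ → Matrix (Fin 3) (Fin 3) ℝ) (W W' : ℝ → Fin 3 → ℝ)
    (hQ : ∀ t, HasDerivAt Q (Q t * hat (W t)) t)
    (hW : ∀ t, HasDerivAt W (W' t) t)
    (hbal : ∀ t, 𝕀 *ᵥ W' t = cross3 (𝕀 *ᵥ W t) (W t) + τ (Q t)) :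
    ∀ t₁ t₂ : ℝ,
      (1 / 2) * dot3 (W t₁) (𝕀 *ᵥ W t₁) + U (Q t₁) =
      (1 / 2) * dot3 (W t₂) (𝕀 *ᵥ W t₂) + U (Q t₂) := by
  have hE : ∀ t, HasDerivAt
      (fun s => (1 / 2) * dot3 (W s) (𝕀 *ᵥ W s) + U (Q s)) 0 t := by
    intro t
    have hkin := ((hW t).dot3 ((hW t).const_mulVec 𝕀)).const_mul (1 / 2 : ℝ)
    have hpot : HasDerivAt (fun s => U (Q s)) (-dot3 (τ (Q t)) (W t)) t := by
      rw [hτ, neg_neg]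
      exact (hU (Q t)).hasFDerivAt.comp_hasDerivAt t (hQ t)
    have hpower : dot3 (𝕀 *ᵥ W' t) (W t) = dot3 (τ (Q t)) (W t) := by
      rw [hbal, dot3_add_left, dot3_cross3_self, zero_add]
    refine (hkin.add hpot).congr_deriv ?_
    rw [h𝕀sym.dot3_mulVec, dot3_comm (W t), hpower]
    ring
  exact is_const_of_deriv_eq_zero (fun t => (hE t).differentiableAt) fun t => (hE t).deriv
end

section
/- (Lyapunov-type stability bound from energy conservation) Let 𝕀 be a symmetric positive-definite 3×3 real matrix with smallest eigenvalue λ > 0, and let U(Q) := (dist(Q,I) − 1)² where dist(Q₁,Q₂) := √(2·tr(I − Q₁ᵀQ₂)). Define τ(Q) ∈ ℝ³ by ⟨τ(Q), y⟩ = −DU(Q)·(Q·ŷ) for all y ∈ ℝ³. Suppose Q : ℝ → 3×3 real matrices and W : ℝ → ℝ³ are differentiable, Q(t) ∈ SO(3) and Q(t) ≠ I for all t, and they satisfy Q′(t) = Q(t)·Ŵ(t) and 𝕀·W′(t) = (𝕀·W(t)) × W(t) + τ(Q(t)). Set E₀ := ½⟨W(0), 𝕀·W(0)⟩ + (dist(Q(0),I)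 − 1)². Then for all t ∈ ℝ: (dist(Q(t),I) − 1)² ≤ E₀ and ‖W(t)‖² ≤ 2E₀/λ. -/
open Matrix

attribute [local instance] Matrix.frobeniusNormedAddCommGroup Matrix.frobeniusNormedSpace

/-- The Euclidean norm on `ℝ³`. -/
noncomputable def enorm3 (x : Fin 3 → ℝ) : ℝ :=
  Real.sqrt (∑ i, x i ^ 2)

/-- Membership in SO(3): `Qᵀ Q = I` and `det Q = 1`. -/
def SO3 (Q : Matrix (Fin 3) (Fin 3) ℝ) : Prop := Qᵀ * Q = 1 ∧ Q.det = 1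

/-- The distance function `dist(Q₁,Q₂) = √(2 · tr(I − Q₁ᵀ Q₂))`. -/
noncomputable def so3Dist (Q₁ Q₂ : Matrix (Fin 3) (Fin 3) ℝ) : ℝ :=
  Real.sqrt (2 * Matrix.trace (1 - Q₁ᵀ * Q₂))

/-- The potential `U(Q) = (dist(Q,I) − 1)²`. -/
noncomputable def U₀ (Q : Matrix (Fin 3) (Fin 3) ℝ) : ℝ := (so3Dist Q 1 - 1) ^ 2

/-- The cross product `x × y` is orthogonal to `y`. -/
theorem dot3_cross3_right (x y : Fin 3 → ℝ) : dot3 y (cross3 x y) = 0 := by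
  simp [dot3, cross3, Fin.sum_univ_three]
  ring

theorem enorm3_sq (x : Fin 3 → ℝ) : enorm3 x ^ 2 = x ⬝ᵥ x := by
  rw [enorm3, Real.sq_sqrt (Finset.sum_nonneg fun i _ => sq_nonneg _)]
  simp [dotProduct, sq]

/-- An orthogonal matrix other than the identity satisfies `tr (I - Q) > 0`. -/
theorem trace_one_sub_pos {n : Type*} [Fintype n] [DecidableEq n] {Q : Matrix n n ℝ}
    (hQ : Qᵀ * Q = 1) (hne : Q ≠ 1) : 0 < trace (1 - Q) := by
  have h1 : trace ((1 - Q)ᵀ * (1 - Q)) = 2 * trace (1 - Q) := by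
    have : (1 - Q)ᵀ * (1 - Q) = (1 - Q) + (1 - Q)ᵀ := by
      rw [transpose_sub, transpose_one, sub_mul, mul_sub, mul_sub, hQ]
      simp only [one_mul, mul_one]
      abel
    rw [this, trace_add, trace_transpose]
    ring
  rw [← conjTranspose_eq_transpose_of_trivial] at h1
  have h2 : 0 ≤ trace ((1 - Q)ᴴ * (1 - Q)) :=
    (posSemidef_conjTranspose_mul_self (1 - Q)).trace_nonneg
  have h3 : trace ((1 - Q)ᴴ * (1 - Q)) ≠ 0 := by
    rw [Ne, trace_conjTranspose_mul_self_eq_zero_iff, sub_eq_zero]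
    exact hne.symm
  have := h2.lt_of_ne' h3
  linarith

theorem so3Dist_one_right (Q : Matrix (Fin 3) (Fin 3) ℝ) :
    so3Dist Q 1 = Real.sqrt (2 * trace (1 - Q)) := by
  rw [so3Dist, mul_one, trace_sub, trace_sub, trace_transpose]

/-- The potential is differentiable at every rotation other than the identity. -/
theorem differentiableAt_U₀ {Q : Matrix (Fin 3) (Fin 3) ℝ} (hQ : SO3 Q) (hne : Q ≠ 1) :
    DifferentiableAt ℝ U₀ Q := by
  have hpos := trace_one_sub_pos hQ.1 hne
  have htr : Differentiable ℝ fun A : Matrix (Fin 3) (Fin 3) ℝ => trace A :=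
    (LinearMap.toContinuousLinearMap (traceLinearMap (Fin 3) ℝ ℝ)).differentiable
  have hU : U₀ = fun A => (Real.sqrt (2 * (trace (1 : Matrix (Fin 3) (Fin 3) ℝ) - trace A)) - 1) ^ 2 := by
    funext A
    rw [U₀, so3Dist_one_right, trace_sub]
  rw [hU]
  rw [trace_sub] at hpos
  exact (((((htr Q).const_sub _).const_mul 2).sqrt (by positivity)).sub_const 1).pow 2

/-- If `lam` bounds the eigenvalues of a symmetric matrix from below, it bounds its Rayleigh
quotient from below. -/
theorem mul_dotProduct_self_le {n : Type*} [Fintype n] [DecidableEq n] {A : Matrix n n ℝ}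
    (hA : A.IsHermitian) {lam : ℝ}
    (h : lam ∈ lowerBounds {μ : ℝ | ∃ v : n → ℝ, v ≠ 0 ∧ A *ᵥ v = μ • v}) (w : n → ℝ) :
    lam * (w ⬝ᵥ w) ≤ w ⬝ᵥ A *ᵥ w := by
  have hB : (A - lam • (1 : Matrix n n ℝ)).IsHermitian :=
    hA.sub (isHermitian_one.smul (IsSelfAdjoint.all lam))
  have hpsd : (A - lam • (1 : Matrix n n ℝ)).PosSemidef := by
    rw [hB.posSemidef_iff_eigenvalues_nonneg]
    intro i
    have hv := hB.mulVec_eigenvectorBasis i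
    rw [sub_mulVec, smul_mulVec, one_mulVec, sub_eq_iff_eq_add, ← add_smul] at hv
    have := h ⟨_, fun h0 => hB.eigenvectorBasis.orthonormal.ne_zero i
      ((WithLp.ofLp_eq_zero 2).mp h0), hv⟩
    simpa using this
  have := hpsd.dotProduct_mulVec_nonneg w
  rw [sub_mulVec, smul_mulVec, one_mulVec, dotProduct_sub, dotProduct_smul] at this
  simpa using this

theorem HasDerivAt.dotProduct_mulVec_self {n : Type*} [Fintype n] {A : Matrix n n ℝ}
    (hA : A.IsHermitian) {w : ℝ → n → ℝ} {w' : n → ℝ} {t : ℝ} (hw : HasDerivAt w w' t) :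
    HasDerivAt (fun s => w s ⬝ᵥ A *ᵥ w s) (2 * (w t ⬝ᵥ A *ᵥ w')) t := by
  have hi := hasDerivAt_pi.mp hw
  have hAw : ∀ i, HasDerivAt (fun s => (A *ᵥ w s) i) ((A *ᵥ w') i) t := fun i =>
    HasDerivAt.fun_sum fun j _ => (hi j).const_mul (A i j)
  have hsymm : w' ⬝ᵥ A *ᵥ w t = w t ⬝ᵥ A *ᵥ w' := by
    have hT : Aᵀ = A := by simpa [IsHermitian] using hA
    rw [dotProduct_mulVec, ← mulVec_transpose, hT, dotProduct_comm]
  have := HasDerivAt.fun_sum fun i (_ : i ∈ Finset.univ) => (hi i).mul (hAw i)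
  refine this.congr_deriv ?_
  rw [Finset.sum_add_distrib, two_mul]
  nth_rewrite 1 [← hsymm]
  rfl

/-- Lyapunov-type stability bound from energy conservation: along solutions of the
rigid body equations with potential `U(Q) = (dist(Q,I) − 1)²`, the potential energy
is bounded by the initial energy `E₀` and `‖W(t)‖² ≤ 2 E₀ / λ`, where `λ > 0` is
the smallest eigenvalue of the inertia matrix `𝕀`. -/
theorem rigid_body_lyapunov_bound
    (𝕀 : Matrix (Fin 3) (Fin 3) ℝ) (h𝕀sym : 𝕀.IsHermitian) (h𝕀pos : 𝕀.PosDef)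
    (lam : ℝ) (hlam : 0 < lam)
    (hmin : IsLeast {μ : ℝ | ∃ v : Fin 3 → ℝ, v ≠ 0 ∧ 𝕀 *ᵥ v = μ • v} lam)
    (τ : Matrix (Fin 3) (Fin 3) ℝ → Fin 3 → ℝ)
    (hτ : ∀ (Q : Matrix (Fin 3) (Fin 3) ℝ) (y : Fin 3 → ℝ),
      dot3 (τ Q) y = -(fderiv ℝ U₀ Q (Q * hat y)))
    (Q : ℝ → Matrix (Fin 3) (Fin 3) ℝ) (W W' : ℝ → Fin 3 → ℝ)
    (hSO : ∀ t, SO3 (Q t)) (hne : ∀ t, Q t ≠ 1)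
    (hQ : ∀ t, HasDerivAt Q (Q t * hat (W t)) t)
    (hW : ∀ t, HasDerivAt W (W' t) t)
    (hbal : ∀ t, 𝕀 *ᵥ W' t = cross3 (𝕀 *ᵥ W t) (W t) + τ (Q t)) :
    ∀ t : ℝ,
      (so3Dist (Q t) 1 - 1) ^ 2 ≤
        (1 / 2) * dot3 (W 0) (𝕀 *ᵥ W 0) + (so3Dist (Q 0) 1 - 1) ^ 2 ∧
      enorm3 (W t) ^ 2 ≤
        2 * ((1 / 2) * dot3 (W 0) (𝕀 *ᵥ W 0) + (so3Dist (Q 0) 1 - 1) ^ 2) / lam := by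
  have hdot : ∀ x y, dot3 x y = x ⬝ᵥ y := fun _ _ => rfl
  have hE : ∀ t, HasDerivAt (fun s => (1 / 2) * dot3 (W s) (𝕀 *ᵥ W s) + U₀ (Q s)) 0 t := by
    intro t
    have hU := (differentiableAt_U₀ (hSO t) (hne t)).hasFDerivAt.comp_hasDerivAt t (hQ t)
    refine ((((hW t).dotProduct_mulVec_self h𝕀sym).const_mul (1 / 2)).add hU).congr_deriv ?_
    have hτt := hτ (Q t) (W t)
    have hcross := dot3_cross3_right (𝕀 *ᵥ W t) (W t)
    rw [hdot] at hτt hcross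
    rw [hbal, dotProduct_add, hcross, dotProduct_comm (W t), hτt]
    have hcancel : ∀ c : ℝ, 1 / 2 * (2 * (0 + -c)) + c = 0 := fun c => by ring
    exact hcancel _
  intro t
  have hconst : (1 / 2) * dot3 (W t) (𝕀 *ᵥ W t) + U₀ (Q t)
      = (1 / 2) * dot3 (W 0) (𝕀 *ᵥ W 0) + U₀ (Q 0) :=
    is_const_of_deriv_eq_zero (fun s => (hE s).differentiableAt) (fun s => (hE s).deriv) t 0
  have hray := mul_dotProduct_self_le h𝕀sym hmin.2 (W t)
  have hWnn : 0 ≤ W t ⬝ᵥ W t := enorm3_sq (W t) ▸ sq_nonneg _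
  have hUnn : 0 ≤ U₀ (Q t) := sq_nonneg _
  have hlamW := mul_nonneg hlam.le hWnn
  rw [← hdot (W t) (𝕀 *ᵥ W t)] at hray
  change U₀ (Q t) ≤ (1 / 2) * dot3 (W 0) (𝕀 *ᵥ W 0) + U₀ (Q 0) ∧
    enorm3 (W t) ^ 2 ≤ 2 * ((1 / 2) * dot3 (W 0) (𝕀 *ᵥ W 0) + U₀ (Q 0)) / lam
  rw [enorm3_sq, le_div_iff₀ hlam, ← hconst]
  constructor <;> linarith
end
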